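/- For every pair of integers n ≥ 4 and k with 4 ≤ k ≤ n, the 3-CNF formula ERPHP has a tree-like resolution refutation of size at most C·k^k·n^k (for an absolute constant C), of width at most 2k+1, and of clause space at most 2k+3. -/

import Mathlib

namespace NarrowProofs

/-- A clause is a finite set of literals; a literal is a variable together with a
sign (`true` = positive literal, `false` = negative literal). -/
abbrev Clause (V : Type) := Finset (V × Bool)

/-- Justification of a step in a resolution derivation: an axiom of the formula,
a resolution inference from two earlier lines `i, j` resolving on variable `x`,
or a weakening of an earlier line `i`. -/
inductive ResJust (V : Type) where
  | ax : ResJust V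
  | res (i j : ℕ) (x : V) : ResJust V
  | weak (i : ℕ) : ResJust V

/-- A resolution refutation of a CNF formula `F`: a sequence of clauses, each one
an axiom of `F`, a resolvent of two earlier clauses, or a weakening of an earlier
clause, ending in the empty clause. -/
structure ResRefutation (V : Type) [DecidableEq V] (F : Set (Clause V)) where
  lines : List (Clause V)
  justs : List (ResJust V)
  len_eq : justs.length = lines.length
  ne : lines ≠ []
  valid : ∀ t C, lines[t]? = some C →
    match justs[t]? with
    | some ResJust.ax => C ∈ F
    | some (ResJust.res i j x) => i < t ∧ j < t ∧ ∃ A B : Clause V,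
        lines[i]? = some A ∧ lines[j]? = some B ∧
        (x, true) ∈ A ∧ (x, false) ∈ B ∧
        C = (A.erase (x, true)) ∪ (B.erase (x, false))
    | some (ResJust.weak i) => i < t ∧ ∃ A : Clause V, lines[i]? = some A ∧ A ⊆ C
    | none => False
  last_empty : lines.getLast ne = ∅

variable {V : Type} [DecidableEq V] {F : Set (Clause V)}

/-- The size (length) of a resolution refutation: the number of clauses. -/
def ResRefutation.size (π : ResRefutation V F) : ℕ := π.lines.length

/-- All clauses in the refutation have at most `w` literals. -/
def ResRefutation.widthLE (π : ResRefutation V F) (w : ℕ) : Prop :=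
  ∀ C ∈ π.lines, C.card ≤ w

/-- Step `t` uses line `i` as a premise. -/
def usesPrem (justs : List (ResJust V)) (t i : ℕ) : Prop :=
  match justs[t]? with
  | some (ResJust.res a b _) => i = a ∨ i = b
  | some (ResJust.weak a) => i = a
  | _ => False

/-- Tree-like: every line is used as a premise at most once. -/
def ResRefutation.treelike (π : ResRefutation V F) : Prop :=
  ∀ i t₁ t₂, usesPrem π.justs t₁ i → usesPrem π.justs t₂ i → t₁ = t₂

/-- The clause space at time `t`: the number of clauses derived at or before
time `t` that are used as premises at or after time `t` (including the clause
derived at time `t` itself). -/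
noncomputable def ResRefutation.spaceAt (π : ResRefutation V F) (t : ℕ) : ℕ :=
  Set.ncard ({i | i ≤ t ∧ ∃ j, t ≤ j ∧ usesPrem π.justs j i} ∪ {t})

/-- The clause space of the refutation is at most `s`. -/
def ResRefutation.spaceLE (π : ResRefutation V F) (s : ℕ) : Prop :=
  ∀ t < π.lines.length, π.spaceAt t ≤ s

/-- The variables of the 3-CNF relativized pigeonhole principle `ERPHP`. -/
inductive ERVar where
  | p (u v : ℕ)
  | q (v w : ℕ)
  | r (v : ℕ)
  | rr (v v' : ℕ)
  | y (u v : ℕ)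
  | z (v w : ℕ)
deriving DecidableEq

/-- The 3-CNF relativized pigeonhole principle formula with `k` pigeons chosen
among `n` and `k-1` holes (all indices are 1-based). -/
def ERPHP (n k : ℕ) : Set (Clause ERVar) :=
  { C |
    (∃ u, 1 ≤ u ∧ u ≤ k ∧
      C = {(ERVar.p u 1, true), (ERVar.p u 2, true), (ERVar.y u 2, true)}) ∨
    (∃ u v, 1 ≤ u ∧ u ≤ k ∧ 2 ≤ v ∧ v ≤ n - 3 ∧
      C = {(ERVar.y u v, false), (ERVar.p u (v+1), true), (ERVar.y u (v+1), true)}) ∨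
    (∃ u, 1 ≤ u ∧ u ≤ k ∧
      C = {(ERVar.y u (n-2), false), (ERVar.p u (n-1), true), (ERVar.p u n, true)}) ∨
    (∃ v, 1 ≤ v ∧ v ≤ n ∧
      C = {(ERVar.r v, false), (ERVar.q v 1, true), (ERVar.z v 1, true)}) ∨
    (∃ v w, 1 ≤ v ∧ v ≤ n ∧ 1 ≤ w ∧ w ≤ k - 4 ∧
      C = {(ERVar.z v w, false), (ERVar.q v (w+1), true), (ERVar.z v (w+1), true)}) ∨
    (∃ v, 1 ≤ v ∧ v ≤ n ∧
      C = {(ERVar.z v (k-3), false), (ERVar.q v (k-2), true), (ERVar.q v (k-1), true)}) ∨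
    (∃ u u' v, 1 ≤ u ∧ u ≤ k ∧ 1 ≤ u' ∧ u' ≤ k ∧ u ≠ u' ∧ 1 ≤ v ∧ v ≤ n ∧
      C = {(ERVar.p u v, false), (ERVar.p u' v, false)}) ∨
    (∃ u v, 1 ≤ u ∧ u ≤ k ∧ 1 ≤ v ∧ v ≤ n ∧
      C = {(ERVar.p u v, false), (ERVar.r v, true)}) ∨
    (∃ v v', 1 ≤ v ∧ v ≤ n ∧ 1 ≤ v' ∧ v' ≤ n ∧ v ≠ v' ∧
      C = {(ERVar.r v, false), (ERVar.r v', false), (ERVar.rr v v', true)}) ∨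
    (∃ v v' w, 1 ≤ v ∧ v ≤ n ∧ 1 ≤ v' ∧ v' ≤ n ∧ v ≠ v' ∧ 1 ≤ w ∧ w ≤ k - 1 ∧
      C = {(ERVar.rr v v', false), (ERVar.q v w, false), (ERVar.q v' w, false)}) }

/-- Bounded tree-like derivability: `Der F W N s C` means that `C` has a tree-like derivation
of width at most `W`, size at most `N` and space at most `s`. -/
inductive Der (F : Set (Clause V)) (W : ℕ) : ℕ → ℕ → Clause V → Prop
  | ax (N s : ℕ) (C : Clause V) : C ∈ F → C.card ≤ W → 1 ≤ s → 1 ≤ N → Der F W N s C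
  | weak (M N s : ℕ) (A C : Clause V) : Der F W M s A → A ⊆ C → C.card ≤ W → 2 ≤ s →
      M + 1 ≤ N → Der F W N s C
  | res (N₁ N₂ N s s' : ℕ) (A B : Clause V) (x : V) : Der F W N₁ s A → Der F W N₂ s' B →
      s' + 1 ≤ s → 3 ≤ s → (x, true) ∈ A → (x, false) ∈ B →
      ((A.erase (x, true)) ∪ (B.erase (x, false))).card ≤ W →
      N₁ + N₂ + 1 ≤ N → Der F W N s ((A.erase (x, true)) ∪ (B.erase (x, false)))
  | res' (N₁ N₂ N s s' : ℕ) (A B : Clause V) (x : V) : Der F W N₁ s B → Der F W N₂ s' A →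
      s' + 1 ≤ s → 3 ≤ s → (x, true) ∈ A → (x, false) ∈ B →
      ((A.erase (x, true)) ∪ (B.erase (x, false))).card ≤ W →
      N₁ + N₂ + 1 ≤ N → Der F W N s ((A.erase (x, true)) ∪ (B.erase (x, false)))

theorem Der.mono {W N s : ℕ} {C : Clause V} (h : Der F W N s C) {N' s' : ℕ}
    (hN : N ≤ N') (hs : s ≤ s') : Der F W N' s' C := by
  induction h generalizing N' s' with
  | ax N s C h1 h2 h3 h4 => exact Der.ax _ _ _ h1 h2 (by omega) (by omega)
  | weak M N s A C h1 h2 h3 h4 h5 ih =>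
    exact Der.weak M _ _ A C (ih le_rfl hs) h2 h3 (by omega) (by omega)
  | res N₁ N₂ N s t A B x h1 h2 h3 h4 h5 h6 h7 h8 ih1 ih2 =>
    exact Der.res N₁ N₂ _ _ t A B x (ih1 le_rfl hs) h2 (by omega) (by omega) h5 h6 h7 (by omega)
  | res' N₁ N₂ N s t A B x h1 h2 h3 h4 h5 h6 h7 h8 ih1 ih2 =>
    exact Der.res' N₁ N₂ _ _ t A B x (ih1 le_rfl hs) h2 (by omega) (by omega) h5 h6 h7 (by omega)

/-- The cut rule with built-in weakening. -/
theorem Der.cut {W N₁ N₂ s s' : ℕ} {A B C : Clause V} (x : V) (hA : Der F W N₁ s A)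
    (hB : Der F W N₂ s' B) (hs : s' + 1 ≤ s) (hs3 : 3 ≤ s)
    (hAC : A ⊆ insert (x, true) C) (hBC : B ⊆ insert (x, false) C) (hC : C.card ≤ W) {N : ℕ}
    (hN : N₁ + N₂ + 2 ≤ N) : Der F W N s C := by
  by_cases h1 : (x, true) ∈ A
  · by_cases h2 : (x, false) ∈ B
    · have hsub : (A.erase (x, true)) ∪ (B.erase (x, false)) ⊆ C := by
        intro l hl
        rcases Finset.mem_union.1 hl with h | h
        · have h' := Finset.mem_erase.1 h
          rcases Finset.mem_insert.1 (hAC h'.2) with hmem | hmem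
          · exact absurd hmem h'.1
          · exact hmem
        · have h' := Finset.mem_erase.1 h
          rcases Finset.mem_insert.1 (hBC h'.2) with hmem | hmem
          · exact absurd hmem h'.1
          · exact hmem
      exact Der.weak (N₁ + N₂ + 1) _ _ _ _
        (Der.res N₁ N₂ _ _ s' A B x hA hB hs hs3 h1 h2
          ((Finset.card_le_card hsub).trans hC) le_rfl) hsub hC (by omega) (by omega)
    · refine Der.weak N₂ _ _ B _ (hB.mono le_rfl (by omega)) ?_ hC (by omega) (by omega)
      intro l hl
      rcases Finset.mem_insert.1 (hBC hl) with hmem | hmem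
      · exact absurd (hmem ▸ hl) h2
      · exact hmem
  · refine Der.weak N₁ _ _ A _ hA ?_ hC (by omega) (by omega)
    intro l hl
    rcases Finset.mem_insert.1 (hAC hl) with hmem | hmem
    · exact absurd (hmem ▸ hl) h1
    · exact hmem

/-- The cut rule with built-in weakening, the negative premise being derived first. -/
theorem Der.cut' {W N₁ N₂ s s' : ℕ} {A B C : Clause V} (x : V) (hB : Der F W N₁ s B)
    (hA : Der F W N₂ s' A) (hs : s' + 1 ≤ s) (hs3 : 3 ≤ s)
    (hAC : A ⊆ insert (x, true) C) (hBC : B ⊆ insert (x, false) C) (hC : C.card ≤ W) {N : ℕ}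
    (hN : N₁ + N₂ + 2 ≤ N) : Der F W N s C := by
  by_cases h1 : (x, true) ∈ A
  · by_cases h2 : (x, false) ∈ B
    · have hsub : (A.erase (x, true)) ∪ (B.erase (x, false)) ⊆ C := by
        intro l hl
        rcases Finset.mem_union.1 hl with h | h
        · have h' := Finset.mem_erase.1 h
          rcases Finset.mem_insert.1 (hAC h'.2) with hmem | hmem
          · exact absurd hmem h'.1
          · exact hmem
        · have h' := Finset.mem_erase.1 h
          rcases Finset.mem_insert.1 (hBC h'.2) with hmem | hmem
          · exact absurd hmem h'.1
          · exact hmem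
      exact Der.weak (N₁ + N₂ + 1) _ _ _ _
        (Der.res' N₁ N₂ _ _ s' A B x hB hA hs hs3 h1 h2
          ((Finset.card_le_card hsub).trans hC) le_rfl) hsub hC (by omega) (by omega)
    · refine Der.weak N₁ _ _ B _ hB ?_ hC (by omega) (by omega)
      intro l hl
      rcases Finset.mem_insert.1 (hBC hl) with hmem | hmem
      · exact absurd (hmem ▸ hl) h2
      · exact hmem
  · refine Der.weak N₂ _ _ A _ (hA.mono le_rfl (by omega)) ?_ hC (by omega) (by omega)
    intro l hl
    rcases Finset.mem_insert.1 (hAC hl) with hmem | hmem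
    · exact absurd (hmem ▸ hl) h1
    · exact hmem

/-- Premises of a justification. -/
def prem (J : ResJust V) (i : ℕ) : Prop :=
  match J with
  | ResJust.res a b _ => i = a ∨ i = b
  | ResJust.weak a => i = a
  | ResJust.ax => False

/-- Correctness of a line at position `t` of a list whose first line has global index `o`. -/
def okLine (F : Set (Clause V)) (o : ℕ) (L : List (Clause V × ResJust V)) (t : ℕ)
    (c : Clause V × ResJust V) : Prop :=
  match c.2 with
  | ResJust.ax => c.1 ∈ F
  | ResJust.res a b x => o ≤ a ∧ a < o + t ∧ o ≤ b ∧ b < o + t ∧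
      ∃ A B : Clause V × ResJust V, L[a - o]? = some A ∧ L[b - o]? = some B ∧
        (x, true) ∈ A.1 ∧ (x, false) ∈ B.1 ∧
        c.1 = (A.1.erase (x, true)) ∪ (B.1.erase (x, false))
  | ResJust.weak a => o ≤ a ∧ a < o + t ∧ ∃ A : Clause V × ResJust V,
      L[a - o]? = some A ∧ A.1 ⊆ c.1

/-- A list of lines, with first global index `o`, forming a bounded tree-like derivation. -/
structure Good (F : Set (Clause V)) (W N s o : ℕ) (C : Clause V)
    (L : List (Clause V × ResJust V)) : Prop where
  len : L.length ≤ N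
  pos : 0 < L.length
  last : ∃ J, L[L.length - 1]? = some (C, J)
  width : ∀ (t : ℕ) (c : Clause V × ResJust V), L[t]? = some c → c.1.card ≤ W
  ok : ∀ (t : ℕ) (c : Clause V × ResJust V), L[t]? = some c → okLine F o L t c
  tree : ∀ (i t₁ t₂ : ℕ) (c₁ c₂ : Clause V × ResJust V), L[t₁]? = some c₁ → L[t₂]? = some c₂ →
    prem c₁.2 i → prem c₂.2 i → t₁ = t₂
  space : ∀ t < L.length, ∃ S : Finset ℕ, S.card ≤ s ∧ o + t ∈ S ∧
    ∀ (i j : ℕ) (c : Clause V × ResJust V), i ≤ o + t → t ≤ j → L[j]? = some c → prem c.2 i → i ∈ S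

theorem okLine.prem_lt {o t : ℕ} {L : List (Clause V × ResJust V)} {c : Clause V × ResJust V}
    (h : okLine F o L t c) {i : ℕ} (hi : prem c.2 i) : o ≤ i ∧ i < o + t := by
  obtain ⟨C, J⟩ := c
  cases J with
  | ax => exact hi.elim
  | res a b x =>
    obtain ⟨h1, h2, h3, h4, _⟩ := h
    rcases hi with rfl | rfl
    · exact ⟨h1, h2⟩
    · exact ⟨h3, h4⟩
  | weak a =>
    obtain ⟨h1, h2, _⟩ := h
    cases hi
    exact ⟨h1, h2⟩

theorem okLine.mono {o t : ℕ} {L L' : List (Clause V × ResJust V)} {c : Clause V × ResJust V}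
    (h : okLine F o L t c) (hL : ∀ (i : ℕ) d, L[i]? = some d → L'[i]? = some d) :
    okLine F o L' t c := by
  obtain ⟨C, J⟩ := c
  cases J with
  | ax => exact h
  | res a b x =>
    obtain ⟨h1, h2, h3, h4, A, B, hA, hB, h5⟩ := h
    exact ⟨h1, h2, h3, h4, A, B, hL _ _ hA, hL _ _ hB, h5⟩
  | weak a =>
    obtain ⟨h1, h2, A, hA, h5⟩ := h
    exact ⟨h1, h2, A, hL _ _ hA, h5⟩

theorem okLine.shift {o l t : ℕ} {L L' : List (Clause V × ResJust V)}
    {c : Clause V × ResJust V}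
    (h : okLine F (o + l) L t c) (hL : ∀ (i : ℕ) d, L[i]? = some d → L'[l + i]? = some d) :
    okLine F o L' (l + t) c := by
  have key : ∀ a d, o + l ≤ a → L[a - (o + l)]? = some d → L'[a - o]? = some d := by
    intro a d ha hd
    have := hL _ _ hd
    rwa [show l + (a - (o + l)) = a - o by omega] at this
  obtain ⟨C, J⟩ := c
  cases J with
  | ax => exact h
  | res a b x =>
    obtain ⟨h1, h2, h3, h4, A, B, hA, hB, h5⟩ := h
    exact ⟨by omega, by omega, by omega, by omega, A, B, key _ _ h1 hA, key _ _ h3 hB, h5⟩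
  | weak a =>
    obtain ⟨h1, h2, A, hA, h5⟩ := h
    exact ⟨by omega, by omega, A, key _ _ h1 hA, h5⟩

theorem getElem?_snoc_cases {α : Type} {L : List α} {d c : α} {t : ℕ}
    (h : (L ++ [d])[t]? = some c) :
    (t < L.length ∧ L[t]? = some c) ∨ (t = L.length ∧ c = d) := by
  rcases lt_trichotomy t L.length with h1 | h1 | h1
  · rw [List.getElem?_append_left h1] at h
    exact Or.inl ⟨h1, h⟩
  · subst h1
    simp at h
    exact Or.inr ⟨rfl, h.symm⟩
  · rw [List.getElem?_eq_none (by simp; omega)] at h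
    cases h

theorem getElem?_app_cases {α : Type} {L M : List α} {c : α} {t : ℕ}
    (h : (L ++ M)[t]? = some c) :
    (t < L.length ∧ L[t]? = some c) ∨ (∃ t', t' < M.length ∧ t = L.length + t' ∧ M[t']? = some c) := by
  rcases lt_or_ge t L.length with h1 | h1
  · rw [List.getElem?_append_left h1] at h
    exact Or.inl ⟨h1, h⟩
  · rw [List.getElem?_append_right h1] at h
    refine Or.inr ⟨t - L.length, ?_, by omega, h⟩
    exact (List.getElem?_eq_some_iff.1 h).1

theorem getElem?_app_left {α : Type} {L M : List α} {c : α} {t : ℕ}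
    (h : L[t]? = some c) : (L ++ M)[t]? = some c := by
  rw [List.getElem?_append_left (List.getElem?_eq_some_iff.1 h).1, h]

theorem getElem?_app_right {α : Type} {L M : List α} {c : α} {t : ℕ}
    (h : M[t]? = some c) : (L ++ M)[L.length + t]? = some c := by
  rw [List.getElem?_append_right (by omega)]
  simpa using h

theorem Good.weaken {W M N s o : ℕ} {A C : Clause V} {L : List (Clause V × ResJust V)}
    (h : Good F W M s o A L) (hAC : A ⊆ C) (hC : C.card ≤ W) (hs : 2 ≤ s) (hN : M + 1 ≤ N) :
    Good F W N s o C (L ++ [(C, ResJust.weak (o + (L.length - 1)))]) := by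
  have hpos := h.pos
  have hlen := h.len
  obtain ⟨JA, hA⟩ := h.last
  refine ⟨by simp; omega, by simp, ⟨_, by simp; rfl⟩, ?_, ?_, ?_, ?_⟩
  · intro t c hc
    rcases getElem?_snoc_cases hc with ⟨_, h1⟩ | ⟨_, rfl⟩
    · exact h.width _ _ h1
    · exact hC
  · intro t c hc
    rcases getElem?_snoc_cases hc with ⟨_, h1⟩ | ⟨rfl, rfl⟩
    · exact (h.ok _ _ h1).mono fun i d hd => getElem?_app_left hd
    · refine ⟨by omega, by omega, (A, JA), ?_, hAC⟩
      rw [show o + (L.length - 1) - o = L.length - 1 by omega]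
      exact getElem?_app_left hA
  · intro i t₁ t₂ c₁ c₂ hc₁ hc₂ hp₁ hp₂
    rcases getElem?_snoc_cases hc₁ with ⟨hl₁, h1⟩ | ⟨rfl, rfl⟩ <;>
      rcases getElem?_snoc_cases hc₂ with ⟨hl₂, h2⟩ | ⟨rfl, rfl⟩
    · exact h.tree _ _ _ _ _ h1 h2 hp₁ hp₂
    · have := (h.ok _ _ h1).prem_lt hp₁
      simp only [prem] at hp₂
      omega
    · have := (h.ok _ _ h2).prem_lt hp₂
      simp only [prem] at hp₁
      omega
    · rfl
  · intro t ht
    simp only [List.length_append, List.length_singleton] at ht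
    rcases Nat.lt_succ_iff_lt_or_eq.1 ht with ht | rfl
    · obtain ⟨S, hS, hm, hu⟩ := h.space t ht
      refine ⟨S, hS, hm, ?_⟩
      intro i j c hi hj hc hp
      rcases getElem?_snoc_cases hc with ⟨hl₁, h1⟩ | ⟨rfl, rfl⟩
      · exact hu i j c hi hj h1 hp
      · simp only [prem] at hp
        have : i = o + t := by omega
        rw [this]; exact hm
    · refine ⟨{o + L.length, o + (L.length - 1)}, ?_, by simp, ?_⟩
      · exact Finset.card_le_two.trans hs
      · intro i j c hi hj hc hp
        rcases getElem?_snoc_cases hc with ⟨hl₁, h1⟩ | ⟨rfl, rfl⟩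
        · omega
        · simp only [prem] at hp
          simp [hp]

theorem Good.join {W N₁ N₂ N s s' o : ℕ} {A B D : Clause V} {J : ResJust V}
    {L M : List (Clause V × ResJust V)}
    (h : Good F W N₁ s o A L) (g : Good F W N₂ s' (o + L.length) B M)
    (hss : s' + 1 ≤ s) (hs : 3 ≤ s)
    (hJ : ∀ i, prem J i → i = o + (L.length - 1) ∨ i = o + L.length + (M.length - 1))
    (hok : ∀ (L' : List (Clause V × ResJust V)) (JA JB : ResJust V),
      L'[o + (L.length - 1) - o]? = some (A, JA) →
      L'[o + L.length + (M.length - 1) - o]? = some (B, JB) →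
      okLine F o L' (L.length + M.length) (D, J))
    (hC : D.card ≤ W) (hN : N₁ + N₂ + 1 ≤ N) :
    Good F W N s o D ((L ++ M) ++ [(D, J)]) := by
  have hpos := h.pos
  have hlen := h.len
  have gpos := g.pos
  have glen := g.len
  obtain ⟨JA, hA⟩ := h.last
  obtain ⟨JB, hB⟩ := g.last
  have cases3 : ∀ {t c}, ((L ++ M) ++ [(D, J)])[t]? = some c →
      (t < L.length ∧ L[t]? = some c) ∨
      (∃ t', t' < M.length ∧ t = L.length + t' ∧ M[t']? = some c) ∨
      (t = L.length + M.length ∧ c = (D, J)) := by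
    intro t c hc
    rcases getElem?_snoc_cases hc with ⟨_, h1⟩ | ⟨h1, h2⟩
    · rcases getElem?_app_cases h1 with h2 | h2
      · exact Or.inl h2
      · exact Or.inr (Or.inl h2)
    · exact Or.inr (Or.inr ⟨by simpa using h1, h2⟩)
  refine ⟨by simp; omega, by simp, ⟨_, by simp [← Nat.add_assoc]; rfl⟩, ?_, ?_, ?_, ?_⟩
  · intro t c hc
    rcases cases3 hc with ⟨_, h1⟩ | ⟨t', _, _, h1⟩ | ⟨_, rfl⟩
    · exact h.width _ _ h1
    · exact g.width _ _ h1
    · exact hC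
  · intro t c hc
    rcases cases3 hc with ⟨_, h1⟩ | ⟨t', _, rfl, h1⟩ | ⟨rfl, rfl⟩
    · exact (h.ok _ _ h1).mono fun i d hd => getElem?_app_left (getElem?_app_left hd)
    · exact (g.ok _ _ h1).shift fun i d hd => getElem?_app_left (getElem?_app_right hd)
    · refine hok _ JA JB ?_ ?_
      · rw [show o + (L.length - 1) - o = L.length - 1 by omega]
        exact getElem?_app_left (getElem?_app_left hA)
      · rw [show o + L.length + (M.length - 1) - o = L.length + (M.length - 1) by omega]
        exact getElem?_app_left (getElem?_app_right hB)
  · intro i t₁ t₂ c₁ c₂ hc₁ hc₂ hp₁ hp₂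
    rcases cases3 hc₁ with ⟨hl₁, h1⟩ | ⟨t₁', hl₁, rfl, h1⟩ | ⟨rfl, rfl⟩ <;>
      rcases cases3 hc₂ with ⟨hl₂, h2⟩ | ⟨t₂', hl₂, rfl, h2⟩ | ⟨rfl, rfl⟩
    · exact h.tree _ _ _ _ _ h1 h2 hp₁ hp₂
    · have := (h.ok _ _ h1).prem_lt hp₁
      have := (g.ok _ _ h2).prem_lt hp₂
      omega
    · have := (h.ok _ _ h1).prem_lt hp₁
      have hp₂ := hJ _ hp₂
      omega
    · have := (g.ok _ _ h1).prem_lt hp₁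
      have := (h.ok _ _ h2).prem_lt hp₂
      omega
    · rw [g.tree _ _ _ _ _ h1 h2 hp₁ hp₂]
    · have := (g.ok _ _ h1).prem_lt hp₁
      have hp₂ := hJ _ hp₂
      omega
    · have := (h.ok _ _ h2).prem_lt hp₂
      have hp₁ := hJ _ hp₁
      omega
    · have := (g.ok _ _ h2).prem_lt hp₂
      have hp₁ := hJ _ hp₁
      omega
    · rfl
  · intro t ht
    simp only [List.length_append, List.length_singleton] at ht
    rcases lt_or_ge t L.length with ht1 | ht1
    · obtain ⟨S, hS, hm, hu⟩ := h.space t ht1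
      refine ⟨S, hS, hm, ?_⟩
      intro i j c hi hj hc hp
      rcases cases3 hc with ⟨hl₁, h1⟩ | ⟨t₁', hl₁, rfl, h1⟩ | ⟨rfl, rfl⟩
      · exact hu i j c hi hj h1 hp
      · have := (g.ok _ _ h1).prem_lt hp
        omega
      · have hp := hJ _ hp
        have : i = o + t := by omega
        rw [this]; exact hm
    rcases lt_or_ge t (L.length + M.length) with ht2 | ht2
    · obtain ⟨S, hS, hm, hu⟩ := g.space (t - L.length) (by omega)
      have e : o + L.length + (t - L.length) = o + t := by omega
      rw [e] at hm hu
      refine ⟨insert (o + (L.length - 1)) S, (Finset.card_insert_le _ _).trans (by omega),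
        Finset.mem_insert_of_mem hm, ?_⟩
      intro i j c hi hj hc hp
      rcases cases3 hc with ⟨hl₁, h1⟩ | ⟨t₁', hl₁, rfl, h1⟩ | ⟨rfl, rfl⟩
      · omega
      · exact Finset.mem_insert_of_mem (hu i _ c hi (by omega) h1 hp)
      · have hp := hJ _ hp
        rcases hp with rfl | hp
        · simp
        · have : i = o + t := by omega
          rw [this]; exact Finset.mem_insert_of_mem hm
    · have ht3 : t = L.length + M.length := by omega
      subst ht3
      refine ⟨{o + (L.length + M.length), o + (L.length - 1), o + L.length + (M.length - 1)},
        Finset.card_le_three.trans hs, by simp, ?_⟩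
      intro i j c hi hj hc hp
      rcases cases3 hc with ⟨hl₁, h1⟩ | ⟨t₁', hl₁, rfl, h1⟩ | ⟨rfl, rfl⟩
      · omega
      · omega
      · have hp := hJ _ hp
        rcases hp with rfl | rfl <;> simp

theorem Good.resolve {W N₁ N₂ N s s' o : ℕ} {A B : Clause V} {x : V}
    {L M : List (Clause V × ResJust V)}
    (h : Good F W N₁ s o A L) (g : Good F W N₂ s' (o + L.length) B M)
    (hss : s' + 1 ≤ s) (hs : 3 ≤ s) (hxA : (x, true) ∈ A) (hxB : (x, false) ∈ B)
    (hC : ((A.erase (x, true)) ∪ (B.erase (x, false))).card ≤ W) (hN : N₁ + N₂ + 1 ≤ N) :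
    Good F W N s o ((A.erase (x, true)) ∪ (B.erase (x, false)))
      ((L ++ M) ++ [((A.erase (x, true)) ∪ (B.erase (x, false)),
        ResJust.res (o + (L.length - 1)) (o + L.length + (M.length - 1)) x)]) := by
  have hpos := h.pos
  have gpos := g.pos
  refine h.join g hss hs (fun i hi => hi) ?_ hC hN
  intro L' JA JB hA hB
  exact ⟨by omega, by omega, by omega, by omega, (A, JA), (B, JB), hA, hB, hxA, hxB, rfl⟩

theorem Good.resolve' {W N₁ N₂ N s s' o : ℕ} {A B : Clause V} {x : V}
    {L M : List (Clause V × ResJust V)}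
    (h : Good F W N₁ s o B L) (g : Good F W N₂ s' (o + L.length) A M)
    (hss : s' + 1 ≤ s) (hs : 3 ≤ s) (hxA : (x, true) ∈ A) (hxB : (x, false) ∈ B)
    (hC : ((A.erase (x, true)) ∪ (B.erase (x, false))).card ≤ W) (hN : N₁ + N₂ + 1 ≤ N) :
    Good F W N s o ((A.erase (x, true)) ∪ (B.erase (x, false)))
      ((L ++ M) ++ [((A.erase (x, true)) ∪ (B.erase (x, false)),
        ResJust.res (o + L.length + (M.length - 1)) (o + (L.length - 1)) x)]) := by
  have hpos := h.pos
  have gpos := g.pos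
  refine h.join g hss hs (fun i hi => Or.symm hi) ?_ hC hN
  intro L' JB JA hB hA
  exact ⟨by omega, by omega, by omega, by omega, (A, JA), (B, JB), hA, hB, hxA, hxB, rfl⟩

theorem Der.good {W N s : ℕ} {C : Clause V} (h : Der F W N s C) :
    ∀ o : ℕ, ∃ L, Good F W N s o C L := by
  induction h with
  | ax N s C h1 h2 h3 h4 =>
    intro o
    have key : ∀ (t : ℕ) (c : Clause V × ResJust V),
        [(C, (ResJust.ax : ResJust V))][t]? = some c → t = 0 ∧ c = (C, ResJust.ax) := by
      intro t c hc
      cases t with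
      | zero => simp at hc; exact ⟨rfl, hc.symm⟩
      | succ t => simp at hc
    refine ⟨[(C, ResJust.ax)], by simpa using h4, by simp, ⟨_, by simp; rfl⟩, ?_, ?_, ?_, ?_⟩
    · intro t c hc
      obtain ⟨rfl, rfl⟩ := key _ _ hc
      exact h2
    · intro t c hc
      obtain ⟨rfl, rfl⟩ := key _ _ hc
      exact h1
    · intro i t₁ t₂ c₁ c₂ hc₁ hc₂ _ _
      rw [(key _ _ hc₁).1, (key _ _ hc₂).1]
    · intro t ht
      refine ⟨{o + t}, by simpa using h3, by simp, ?_⟩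
      intro i j c _ _ hc hp
      obtain ⟨rfl, rfl⟩ := key _ _ hc
      exact hp.elim
  | weak M N s A C h1 h2 h3 h4 h5 ih =>
    intro o
    obtain ⟨L, hL⟩ := ih o
    exact ⟨_, hL.weaken h2 h3 h4 h5⟩
  | res N₁ N₂ N s t A B x h1 h2 h3 h4 h5 h6 h7 h8 ih1 ih2 =>
    intro o
    obtain ⟨L, hL⟩ := ih1 o
    obtain ⟨M, hM⟩ := ih2 (o + L.length)
    exact ⟨_, hL.resolve hM h3 h4 h5 h6 h7 h8⟩
  | res' N₁ N₂ N s t A B x h1 h2 h3 h4 h5 h6 h7 h8 ih1 ih2 =>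
    intro o
    obtain ⟨L, hL⟩ := ih1 o
    obtain ⟨M, hM⟩ := ih2 (o + L.length)
    exact ⟨_, hL.resolve' hM h3 h4 h5 h6 h7 h8⟩

theorem usesPrem_map {L : List (Clause V × ResJust V)} {t i : ℕ}
    (h : usesPrem (L.map Prod.snd) t i) : ∃ c, L[t]? = some c ∧ prem c.2 i := by
  unfold usesPrem at h
  rw [List.getElem?_map] at h
  cases hc : L[t]? with
  | none => rw [hc] at h; exact h.elim
  | some c =>
    rw [hc] at h
    refine ⟨c, rfl, ?_⟩
    obtain ⟨C, J⟩ := c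
    cases J with
    | ax => exact h
    | res a b x => exact h
    | weak a => exact h

theorem Der.refutation {W N s : ℕ} (h : Der F W N s ∅) :
    ∃ π : ResRefutation V F, π.size ≤ N ∧ π.widthLE W ∧ π.spaceLE s ∧ π.treelike := by
  obtain ⟨L, hL⟩ := h.good 0
  have hpos := hL.pos
  have hne : L.map Prod.fst ≠ [] := by
    intro h0
    rw [List.map_eq_nil_iff] at h0
    simp [h0] at hpos
  refine ⟨⟨L.map Prod.fst, L.map Prod.snd, by simp, hne, ?_, ?_⟩, ?_, ?_, ?_, ?_⟩
  · intro t C hC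
    rw [List.getElem?_map] at hC ⊢
    cases hc : L[t]? with
    | none => rw [hc] at hC; cases hC
    | some c =>
      rw [hc] at hC
      have hok := hL.ok _ _ hc
      obtain ⟨D, J⟩ := c
      simp only [Option.map_some, Option.some.injEq] at hC
      subst hC
      cases J with
      | ax => exact hok
      | res a b x =>
        obtain ⟨h1, h2, h3, h4, A, B, hA, hB, h5⟩ := hok
        refine ⟨by omega, by omega, A.1, B.1, ?_, ?_, h5⟩
        · rw [List.getElem?_map]; simp at hA; simp [hA]
        · rw [List.getElem?_map]; simp at hB; simp [hB]
      | weak a =>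
        obtain ⟨h1, h2, A, hA, h5⟩ := hok
        refine ⟨by omega, A.1, ?_, h5⟩
        rw [List.getElem?_map]; simp at hA; simp [hA]
  · obtain ⟨J, hJ⟩ := hL.last
    obtain ⟨hlt, hJ⟩ := List.getElem?_eq_some_iff.1 hJ
    rw [List.getLast_eq_getElem]
    simp [hJ]
  · simpa [ResRefutation.size] using hL.len
  · intro C hC
    obtain ⟨c, hc, rfl⟩ := List.mem_map.1 hC
    obtain ⟨t, ht⟩ := List.mem_iff_getElem?.1 hc
    exact hL.width _ _ ht
  · intro t ht
    obtain ⟨S, hS, hm, hu⟩ := hL.space t (by simpa using ht)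
    unfold ResRefutation.spaceAt
    refine le_trans ?_ hS
    rw [← Set.ncard_coe_finset]
    refine Set.ncard_le_ncard ?_ S.finite_toSet
    rintro i (⟨hi, j, hj, hp⟩ | hi)
    · obtain ⟨c, hc, hp⟩ := usesPrem_map hp
      exact hu i j c (by omega) hj hc hp
    · rw [Set.mem_singleton_iff] at hi
      subst hi
      simpa using hm
  · intro i t₁ t₂ h1 h2
    obtain ⟨c₁, hc₁, hp₁⟩ := usesPrem_map h1
    obtain ⟨c₂, hc₂, hp₂⟩ := usesPrem_map h2
    exact hL.tree _ _ _ _ _ hc₁ hc₂ hp₁ hp₂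

/-- Eliminating a wide disjunction encoded by a chain of 3-clauses. -/
theorem chain {W N s m : ℕ} {C : Clause V} (a b : ℕ → V) (hs : 2 ≤ s) (hC : C.card + 2 ≤ W)
    (hW : 3 ≤ W) (j₀ : ℕ)
    (hsub : ∀ j, j₀ ≤ j → j ≤ m + 2 → Der F W N s (insert (a j, false) C))
    (hmid : ∀ j, j₀ ≤ j → j < m →
      ({(b j, false), (a (j + 1), true), (b (j + 1), true)} : Clause V) ∈ F)
    (hend : ({(b m, false), (a (m + 1), true), (a (m + 2), true)} : Clause V) ∈ F) :
    ∀ (d j : ℕ), j + d = m → j₀ ≤ j → ∀ N₀,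
      Der F W N₀ (s + 1) (insert (a j, true) (insert (b j, true) C)) →
      Der F W (N₀ + (d + 3) * (N + 5)) (s + 1) C := by
  have c1 : ∀ l, (insert l C).card ≤ W := fun l => (Finset.card_insert_le _ _).trans (by omega)
  have c2 : ∀ l l', (insert l (insert l' C)).card ≤ W := fun l l' =>
    (Finset.card_insert_le _ _).trans (by have := Finset.card_insert_le l' C; omega)
  have c3 : ∀ l₁ l₂ l₃ : V × Bool, ({l₁, l₂, l₃} : Clause V).card ≤ W := fun _ _ _ =>
    Finset.card_le_three.trans hW
  have step : ∀ (j N₀ : ℕ) (e₁ e₂ : V × Bool), j₀ ≤ j → j ≤ m + 2 →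
      ({(b j, false), e₁, e₂} : Clause V) ∈ F →
      Der F W N₀ (s + 1) (insert (a j, true) (insert (b j, true) C)) →
      Der F W (N₀ + (N + 5)) (s + 1) (insert e₁ (insert e₂ C)) := by
    intro j N₀ e₁ e₂ h1 h2 hF hD
    have h3 : Der F W (N₀ + N + 2) (s + 1) (insert (b j, true) C) :=
      Der.cut (a j) hD (hsub j h1 h2) le_rfl (by omega) (Finset.Subset.refl _)
        (Finset.insert_subset_insert _ (Finset.subset_insert _ _)) (c1 _) le_rfl
    refine Der.cut (b j) h3 (Der.ax 1 1 _ hF (c3 _ _ _) le_rfl le_rfl) (by omega) (by omega)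
      (Finset.insert_subset_insert _ ?_) ?_ (c2 _ _) (by omega)
    · exact (Finset.subset_insert _ _).trans (Finset.subset_insert _ _)
    · intro l hl
      simp only [Finset.mem_insert, Finset.mem_singleton] at hl ⊢
      tauto
  intro d
  induction d with
  | zero =>
    intro j hj hj0 N₀ hD
    have hj' : j = m := by omega
    subst hj'
    have h1 := step j N₀ _ _ hj0 (by omega) hend hD
    have h2 : Der F W (N₀ + (N + 5) + N + 2) (s + 1) (insert (a (j + 2), true) C) :=
      Der.cut (a (j + 1)) h1 (hsub (j + 1) (by omega) (by omega)) le_rfl (by omega)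
        (Finset.Subset.refl _)
        (Finset.insert_subset_insert _ (Finset.subset_insert _ _)) (c1 _) le_rfl
    exact Der.cut (a (j + 2)) h2 (hsub (j + 2) (by omega) (by omega)) le_rfl (by omega)
      (Finset.Subset.refl _) (Finset.Subset.refl _) (by omega) (by omega)
  | succ d ih =>
    intro j hj hj0 N₀ hD
    have h1 := step j N₀ _ _ hj0 (by omega) (hmid j hj0 (by omega)) hD
    refine (ih (j + 1) (by omega) (by omega) _ h1).mono (le_of_eq (by ring)) le_rfl

/-- The leaves: a clause forbidding a full assignment of pigeons and holes. -/
theorem leaf {n k : ℕ} (hk : 4 ≤ k) (C : Clause ERVar) (v w : ℕ → ℕ)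
    (hv : ∀ u, 1 ≤ u → u ≤ k → 1 ≤ v u ∧ v u ≤ n)
    (hw : ∀ u, 1 ≤ u → u ≤ k → 1 ≤ w u ∧ w u ≤ k - 1)
    (hp : ∀ u, 1 ≤ u → u ≤ k → (ERVar.p u (v u), false) ∈ C)
    (hq : ∀ u, 1 ≤ u → u ≤ k → (ERVar.q (v u) (w u), false) ∈ C)
    (hC : C.card ≤ 2 * k) : Der (ERPHP n k) (2 * k + 1) 10 3 C := by
  obtain ⟨u, hu, u', hu', hne, he⟩ : ∃ u ∈ Finset.Icc 1 k, ∃ u' ∈ Finset.Icc 1 k, u ≠ u' ∧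
      w u = w u' := by
    refine Finset.exists_ne_map_eq_of_card_lt_of_maps_to (t := Finset.Icc 1 (k - 1)) ?_ ?_
    · simp; omega
    · intro u hu
      simp only [Finset.coe_Icc, Set.mem_Icc] at hu ⊢
      exact hw u hu.1 hu.2
  rw [Finset.mem_Icc] at hu hu'
  obtain ⟨hu1, hu2⟩ := hu
  obtain ⟨hu1', hu2'⟩ := hu'
  have c3 : ∀ l₁ l₂ l₃ : ERVar × Bool, ({l₁, l₂, l₃} : Clause ERVar).card ≤ 2 * k + 1 :=
    fun _ _ _ => Finset.card_le_three.trans (by omega)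
  have c2 : ∀ l₁ l₂ : ERVar × Bool, ({l₁, l₂} : Clause ERVar).card ≤ 2 * k + 1 :=
    fun _ _ => Finset.card_le_two.trans (by omega)
  obtain ⟨hv1, hv2⟩ := hv u hu1 hu2
  obtain ⟨hv1', hv2'⟩ := hv u' hu1' hu2'
  have hpu := hp u hu1 hu2
  have hpu' := hp u' hu1' hu2'
  have hqu := hq u hu1 hu2
  have hqu' := hq u' hu1' hu2'
  rw [← he] at hqu'
  obtain ⟨hw1, hw2⟩ := hw u hu1 hu2
  by_cases hvv : v u = v u'
  · have hF : ({(ERVar.p u (v u), false), (ERVar.p u' (v u), false)} : Clause ERVar) ∈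
        ERPHP n k :=
      Or.inr (Or.inr (Or.inr (Or.inr (Or.inr (Or.inr (Or.inl
        ⟨u, u', v u, hu1, hu2, hu1', hu2', hne, hv1, hv2, rfl⟩))))))
    refine Der.weak 1 _ _ _ _ (Der.ax 1 3 _ hF (c2 _ _) (by omega) le_rfl) ?_ (by omega)
      (by omega) (by omega)
    intro l hl
    simp only [Finset.mem_insert, Finset.mem_singleton] at hl
    rcases hl with rfl | rfl
    · exact hpu
    · rw [hvv]; exact hpu'
  · have hF1 : ({(ERVar.r (v u), false), (ERVar.r (v u'), false),
        (ERVar.rr (v u) (v u'), true)} : Clause ERVar) ∈ ERPHP n k :=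
      Or.inr (Or.inr (Or.inr (Or.inr (Or.inr (Or.inr (Or.inr (Or.inr (Or.inl
        ⟨v u, v u', hv1, hv2, hv1', hv2', hvv, rfl⟩))))))))
    have hF2 : ({(ERVar.rr (v u) (v u'), false), (ERVar.q (v u) (w u), false),
        (ERVar.q (v u') (w u), false)} : Clause ERVar) ∈ ERPHP n k :=
      Or.inr (Or.inr (Or.inr (Or.inr (Or.inr (Or.inr (Or.inr (Or.inr (Or.inr
        ⟨v u, v u', w u, hv1, hv2, hv1', hv2', hvv, hw1, hw2, rfl⟩))))))))
    have hF3 : ∀ x, 1 ≤ x → x ≤ k →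
        ({(ERVar.p x (v x), false), (ERVar.r (v x), true)} : Clause ERVar) ∈ ERPHP n k :=
      fun x hx1 hx2 => Or.inr (Or.inr (Or.inr (Or.inr (Or.inr (Or.inr (Or.inr (Or.inl
        ⟨x, v x, hx1, hx2, (hv x hx1 hx2).1, (hv x hx1 hx2).2, rfl⟩)))))))
    have d1 : Der (ERPHP n k) (2 * k + 1) 4 3 {(ERVar.r (v u), false), (ERVar.r (v u'), false),
        (ERVar.q (v u) (w u), false), (ERVar.q (v u') (w u), false)} := by
      refine Der.cut (ERVar.rr (v u) (v u')) (Der.ax 1 3 _ hF1 (c3 _ _ _) (by omega) le_rfl)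
        (Der.ax 1 1 _ hF2 (c3 _ _ _) le_rfl le_rfl) (by omega) le_rfl ?_ ?_
        (Finset.card_le_four.trans (by omega)) le_rfl
      · intro l hl
        simp only [Finset.mem_insert, Finset.mem_singleton] at hl ⊢
        tauto
      · intro l hl
        simp only [Finset.mem_insert, Finset.mem_singleton] at hl ⊢
        tauto
    have d2' : Der (ERPHP n k) (2 * k + 1) 1 1
        {(ERVar.p u (v u), false), (ERVar.r (v u), true)} :=
      Der.ax 1 1 _ (hF3 u hu1 hu2) (c2 _ _) (by omega) le_rfl
    have d3 : Der (ERPHP n k) (2 * k + 1) 1 1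
        {(ERVar.p u' (v u'), false), (ERVar.r (v u'), true)} :=
      Der.ax 1 1 _ (hF3 u' hu1' hu2') (c2 _ _) (by omega) le_rfl
    have d4 := Der.cut' (C := {(ERVar.p u (v u), false), (ERVar.r (v u'), false),
        (ERVar.q (v u) (w u), false), (ERVar.q (v u') (w u), false)}) (ERVar.r (v u)) d1 d2'
      (by omega) le_rfl ?_ ?_ (Finset.card_le_four.trans (by omega)) (le_refl 7)
    · refine Der.cut' (ERVar.r (v u')) d4 d3 (by omega) le_rfl ?_ ?_ (by omega) le_rfl
      · intro l hl
        simp only [Finset.mem_insert, Finset.mem_singleton] at hl ⊢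
        rcases hl with rfl | rfl <;> tauto
      · intro l hl
        simp only [Finset.mem_insert, Finset.mem_singleton] at hl ⊢
        rcases hl with rfl | rfl | rfl | rfl <;> tauto
    · intro l hl
      simp only [Finset.mem_insert, Finset.mem_singleton] at hl ⊢
      tauto
    · intro l hl
      simp only [Finset.mem_insert, Finset.mem_singleton] at hl ⊢
      tauto

theorem main_induction {n k : ℕ} (hn : 4 ≤ n) (hk : 4 ≤ k) :
    ∀ (d i : ℕ), i + d = k → ∀ (C : Clause ERVar) (v w : ℕ → ℕ),
    (∀ u, 1 ≤ u → u ≤ i → 1 ≤ v u ∧ v u ≤ n) →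
    (∀ u, 1 ≤ u → u ≤ i → 1 ≤ w u ∧ w u ≤ k - 1) →
    (∀ u, 1 ≤ u → u ≤ i → (ERVar.p u (v u), false) ∈ C) →
    (∀ u, 1 ≤ u → u ≤ i → (ERVar.q (v u) (w u), false) ∈ C) →
    C.card ≤ 2 * i →
    Der (ERPHP n k) (2 * k + 1) (24 * (k * n) ^ d - 14) (2 * d + 3) C := by
  have c3 : ∀ l₁ l₂ l₃ : ERVar × Bool, ({l₁, l₂, l₃} : Clause ERVar).card ≤ 2 * k + 1 :=
    fun _ _ _ => Finset.card_le_three.trans (by omega)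
  have c2 : ∀ l₁ l₂ : ERVar × Bool, ({l₁, l₂} : Clause ERVar).card ≤ 2 * k + 1 :=
    fun _ _ => Finset.card_le_two.trans (by omega)
  intro d
  induction d with
  | zero =>
    intro i hi C v w hv hw hp hq hC
    have : i = k := by omega
    subst this
    simpa using leaf hk C v w hv hw hp hq hC
  | succ d ih =>
    intro i hi C v w hv hw hp hq hC
    have hi1 : 1 ≤ i + 1 := by omega
    have hik : i + 1 ≤ k := by omega
    have sub : ∀ v', 1 ≤ v' → v' ≤ n →
        Der (ERPHP n k) (2 * k + 1) (4 + (k - 1) * (24 * (k * n) ^ d - 14 + 5)) (2 * d + 4)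
          (insert (ERVar.p (i + 1) v', false) C) := by
      intro v' hv1 hv2
      have hC1 : (insert (ERVar.p (i + 1) v', false) C).card ≤ 2 * i + 1 :=
        (Finset.card_insert_le _ _).trans (by omega)
      have start : Der (ERPHP n k) (2 * k + 1) 4 (2 * d + 3 + 1)
          (insert (ERVar.q v' 1, true) (insert (ERVar.z v' 1, true)
            (insert (ERVar.p (i + 1) v', false) C))) := by
        refine Der.cut (N₁ := 1) (N₂ := 1) (s' := 1)
          (A := {(ERVar.p (i + 1) v', false), (ERVar.r v', true)})
          (B := {(ERVar.r v', false), (ERVar.q v' 1, true), (ERVar.z v' 1, true)})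
          (ERVar.r v') (Der.ax _ _ _ ?_ (c2 _ _) (by omega) le_rfl)
          (Der.ax _ _ _ ?_ (c3 _ _ _) (by omega) le_rfl) (by omega) (by omega) ?_ ?_ ?_ le_rfl
        · exact Or.inr (Or.inr (Or.inr (Or.inr (Or.inr (Or.inr (Or.inr (Or.inl
            ⟨i + 1, v', hi1, hik, hv1, hv2, rfl⟩)))))))
        · exact Or.inr (Or.inr (Or.inr (Or.inl ⟨v', hv1, hv2, rfl⟩)))
        · intro l hl
          simp only [Finset.mem_insert, Finset.mem_singleton] at hl ⊢
          tauto
        · intro l hl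
          simp only [Finset.mem_insert, Finset.mem_singleton] at hl ⊢
          tauto
        · refine (Finset.card_insert_le _ _).trans ?_
          have := Finset.card_insert_le (ERVar.z v' 1, true)
            (insert (ERVar.p (i + 1) v', false) C)
          omega
      have hchain := chain (F := ERPHP n k) (W := 2 * k + 1) (N := 24 * (k * n) ^ d - 14)
        (s := 2 * d + 3) (m := k - 3) (C := insert (ERVar.p (i + 1) v', false) C)
        (fun w' => ERVar.q v' w') (fun w' => ERVar.z v' w') (by omega) (by omega) (by omega) 1
        ?_ ?_ ?_ (k - 4) 1 (by omega) le_rfl 4 start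
      · rwa [show k - 4 + 3 = k - 1 by omega] at hchain
      · intro w' hw1 hw2
        refine ih (i + 1) (by omega) _ (Function.update v (i + 1) v')
          (Function.update w (i + 1) w') ?_ ?_ ?_ ?_ ?_
        · intro u h1 h2
          rcases eq_or_ne u (i + 1) with rfl | h
          · simp [hv1, hv2]
          · rw [Function.update_of_ne h]
            exact hv u h1 (by omega)
        · intro u h1 h2
          rcases eq_or_ne u (i + 1) with rfl | h
          · rw [Function.update_self]
            omega
          · rw [Function.update_of_ne h]
            exact hw u h1 (by omega)
        · intro u h1 h2
          rcases eq_or_ne u (i + 1) with rfl | h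
          · simp
          · rw [Function.update_of_ne h]
            exact Finset.mem_insert_of_mem (Finset.mem_insert_of_mem (hp u h1 (by omega)))
        · intro u h1 h2
          rcases eq_or_ne u (i + 1) with rfl | h
          · simp
          · rw [Function.update_of_ne h, Function.update_of_ne h]
            exact Finset.mem_insert_of_mem (Finset.mem_insert_of_mem (hq u h1 (by omega)))
        · exact (Finset.card_insert_le _ _).trans (by omega)
      · intro j h1 h2
        exact Or.inr (Or.inr (Or.inr (Or.inr (Or.inl
          ⟨v', j, hv1, hv2, h1, by omega, rfl⟩))))
      · refine Or.inr (Or.inr (Or.inr (Or.inr (Or.inr (Or.inl ⟨v', hv1, hv2, ?_⟩)))))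
        rw [show k - 3 + 1 = k - 2 by omega, show k - 3 + 2 = k - 1 by omega]
    generalize hN : 4 + (k - 1) * (24 * (k * n) ^ d - 14 + 5) = N at sub
    have start : Der (ERPHP n k) (2 * k + 1) (N + 3) (2 * d + 4 + 1)
        (insert (ERVar.p (i + 1) 2, true) (insert (ERVar.y (i + 1) 2, true) C)) := by
      refine Der.cut (N₁ := 1) (ERVar.p (i + 1) 1)
        (A := {(ERVar.p (i + 1) 1, true), (ERVar.p (i + 1) 2, true), (ERVar.y (i + 1) 2, true)})
        (Der.ax _ _ _ ?_ (c3 _ _ _) (by omega) le_rfl)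
        (sub 1 le_rfl (by omega)) le_rfl (by omega) ?_ ?_ ?_ (by omega)
      · exact Or.inl ⟨i + 1, hi1, hik, rfl⟩
      · intro l hl
        simp only [Finset.mem_insert, Finset.mem_singleton] at hl ⊢
        tauto
      · intro l hl
        simp only [Finset.mem_insert] at hl ⊢
        tauto
      · refine (Finset.card_insert_le _ _).trans ?_
        have := Finset.card_insert_le (ERVar.y (i + 1) 2, true) C
        omega
    have hchain := chain (F := ERPHP n k) (W := 2 * k + 1) (N := N)
      (s := 2 * d + 4) (m := n - 2) (C := C)
      (fun v' => ERVar.p (i + 1) v') (fun v' => ERVar.y (i + 1) v') (by omega) (by omega)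
      (by omega) 2 ?_ ?_ ?_ (n - 4) 2 (by omega) le_rfl (N + 3) start
    · refine hchain.mono ?_ (by omega)
      have hP : 1 ≤ (k * n) ^ d := Nat.one_le_pow _ _ (by positivity)
      rw [pow_succ]
      generalize (k * n) ^ d = P at hP hN
      obtain ⟨K, rfl⟩ : ∃ K, k = K + 1 := ⟨k - 1, by omega⟩
      obtain ⟨m, rfl⟩ : ∃ m, n = m + 1 := ⟨n - 1, by omega⟩
      obtain ⟨Q, rfl⟩ : ∃ Q, P = Q + 1 := ⟨P - 1, by omega⟩
      rw [show m + 1 - 4 + 3 = m by omega]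
      simp only [Nat.add_sub_cancel] at hN
      rw [show 24 * (Q + 1) - 14 + 5 = 24 * Q + 15 by omega] at hN
      apply Nat.le_sub_of_add_le
      subst hN
      have h3 : 3 ≤ K := by omega
      nlinarith [Nat.zero_le (K * Q), Nat.zero_le (m * Q), Nat.zero_le (K * m),
        Nat.zero_le (K * m * Q), Nat.zero_le Q, Nat.zero_le m,
        Nat.mul_le_mul h3 (le_refl m)]
    · intro v' h1 h2
      exact sub v' (by omega) (by omega)
    · intro j h1 h2
      exact Or.inr (Or.inl ⟨i + 1, j, hi1, hik, h1, by omega, rfl⟩)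
    · refine Or.inr (Or.inr (Or.inl ⟨i + 1, hi1, hik, ?_⟩))
      rw [show n - 2 + 1 = n - 1 by omega, show n - 2 + 2 = n by omega]

/-- for all integers `n ≥ 4` and `4 ≤ k ≤ n`, the 3-CNF formula
`ERPHP` has a tree-like resolution refutation of size at most `C·k^k·n^k`
(for an absolute constant `C`), width at most `2k+1`, and clause space at
most `2k+3`. -/
theorem erphp_treelike_upper_bound :
    ∃ C : ℕ, 0 < C ∧ ∀ n k : ℕ, 4 ≤ n → 4 ≤ k → k ≤ n →
      ∃ π : ResRefutation ERVar (ERPHP n k),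
        π.size ≤ C * k ^ k * n ^ k ∧
        π.widthLE (2 * k + 1) ∧
        π.spaceLE (2 * k + 3) ∧
        π.treelike := by
  refine ⟨24, by omega, fun n k hn hk _ => ?_⟩
  have h := main_induction hn hk k 0 (by omega) ∅ (fun _ => 0) (fun _ => 0)
    (fun u h1 h2 => by omega) (fun u h1 h2 => by omega) (fun u h1 h2 => by omega)
    (fun u h1 h2 => by omega) (by simp)
  refine Der.refutation (h.mono ?_ le_rfl)
  rw [mul_pow, ← mul_assoc]
  omega

end NarrowProofs
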